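/- arXiv:1804.00355 — 2 statements merged into one kernel-verified Lean document; each statement's English description precedes it below -/
import Mathlib

section
/- In a good observation scheme, for the linear-form recovery problem suppose in addition that for every pair i,j ≤ I there exists x̄_{ij} ∈ X_i ∩ X_j with A_i(x̄_{ij}) = A_j(x̄_{ij}). Then for every ε ∈ (0,1/2) and positive integers K ≥ K̄, one has Opt(K) ≤ [2 ln(2I/ε) / ln(1/(4ε(1−ε)))] · Risk*_ε(K̄), where Opt(K) = max_{i,j} Opt_{ij}(K) with Opt_{ij}(K) = inf{ ½[Ψ_{i,+}(α,φ) + Ψ_{j,−}(α,φ)] : α > 0, φ ∈ F }. -/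
open MeasureTheory

/-- A *good observation scheme* `((Ω,P), {p_μ : μ ∈ M}, F)` in the sense of
Goldenshluger–Juditsky–Nemirovski: `Ω` is a Polish space carrying a σ-finite Borel
measure `P` of full support, `M ⊆ ℝ^m` is a convex relatively open set, each `p_μ`
(`μ ∈ M`) is a positive probability density w.r.t. `P`, jointly continuous in `(μ,ω)`,
and `F` is a finite-dimensional space of continuous functions containing the constants
and all log-likelihood ratios, on which the function
`Φ(φ;μ) = ln ∫ e^{φ} p_μ dP` is real-valued and concave in `μ`. -/
structure GoodOS (Ω : Type) [TopologicalSpace Ω] [PolishSpace Ω] [MeasurableSpace Ω]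
    [BorelSpace Ω] (m : ℕ) where
  P : Measure Ω
  sigmaFinite : SigmaFinite P
  full_support : ∀ U : Set Ω, IsOpen U → U.Nonempty → 0 < P U
  M : Set (Fin m → ℝ)
  M_convex : Convex ℝ M
  M_relatively_open : IsOpen (Subtype.val ⁻¹' M : Set (affineSpan ℝ M))
  p : (Fin m → ℝ) → Ω → ℝ
  p_pos : ∀ μ ∈ M, ∀ ω : Ω, 0 < p μ ω
  p_cont : ContinuousOn (fun q : (Fin m → ℝ) × Ω => p q.1 q.2) (M ×ˢ Set.univ)
  p_prob : ∀ μ ∈ M, ∫ ω, p μ ω ∂P = 1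
  F : Submodule ℝ (Ω → ℝ)
  F_finiteDimensional : FiniteDimensional ℝ F
  F_cont : ∀ φ ∈ F, Continuous φ
  F_const : ∀ c : ℝ, (fun _ : Ω => c) ∈ F
  F_logratio : ∀ μ ∈ M, ∀ ν ∈ M, (fun ω => Real.log (p μ ω / p ν ω)) ∈ F
  mgf_integrable : ∀ φ ∈ F, ∀ μ ∈ M,
    Integrable (fun ω => Real.exp (φ ω) * p μ ω) P
  mgf_pos : ∀ φ ∈ F, ∀ μ ∈ M, 0 < ∫ ω, Real.exp (φ ω) * p μ ω ∂P
  mgf_concave : ∀ φ ∈ F,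
    ConcaveOn ℝ M fun μ => Real.log (∫ ω, Real.exp (φ ω) * p μ ω ∂P)

/-- The distribution of `K` i.i.d. observations drawn from the distribution with density
`f` w.r.t. `P`. -/
noncomputable def prodDensityMeasure {Ω : Type*} [MeasurableSpace Ω] (P : Measure Ω)
    (K : ℕ) (f : Ω → ℝ) : Measure (Fin K → Ω) :=
  (Measure.pi fun _ : Fin K => P).withDensity fun y => ENNReal.ofReal (∏ k, f (y k))

/-- `Φ_O(φ;μ) = ln ∫ e^{φ} p_μ dP`. -/
noncomputable def GoodOS.Phi {Ω : Type} [TopologicalSpace Ω] [PolishSpace Ω]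
    [MeasurableSpace Ω] [BorelSpace Ω] {m : ℕ} (O : GoodOS Ω m)
    (φ : Ω → ℝ) (μ : Fin m → ℝ) : ℝ :=
  Real.log (∫ ω, Real.exp (φ ω) * O.p μ ω ∂O.P)

section LinearProblem

variable {Ω : Type} [TopologicalSpace Ω] [PolishSpace Ω] [MeasurableSpace Ω]
  [BorelSpace Ω] {m n : ℕ} {ι : Type} [Fintype ι] [Nonempty ι]
  (O : GoodOS Ω m) (X : ι → Set (Fin n → ℝ))
  (A : ι → (Fin n → ℝ) →ᵃ[ℝ] (Fin m → ℝ)) (g : Fin n → ℝ) (ε : ℝ) (K : ℕ)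

/-- `Ψ_{ℓ,+}(β,ψ) = max_{x ∈ X_ℓ} [KβΦ(ψ/β; A_ℓ(x)) − gᵀx + β ln(2I/ε)]`. -/
noncomputable def PsiPlus (ℓ : ι) (β : ℝ) (ψ : Ω → ℝ) : ℝ :=
  sSup {v | ∃ x ∈ X ℓ, v = (K : ℝ) * β * O.Phi (fun ω => ψ ω / β) (A ℓ x)
    - (∑ i, g i * x i) + β * Real.log (2 * (Fintype.card ι : ℝ) / ε)}

/-- `Ψ_{ℓ,−}(β,ψ) = max_{x ∈ X_ℓ} [KβΦ(−ψ/β; A_ℓ(x)) + gᵀx + β ln(2I/ε)]`. -/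
noncomputable def PsiMinus (ℓ : ι) (β : ℝ) (ψ : Ω → ℝ) : ℝ :=
  sSup {v | ∃ x ∈ X ℓ, v = (K : ℝ) * β * O.Phi (fun ω => -ψ ω / β) (A ℓ x)
    + (∑ i, g i * x i) + β * Real.log (2 * (Fintype.card ι : ℝ) / ε)}

/-- `Opt_{ij}(K) = inf {½[Ψ_{i,+}(α,φ) + Ψ_{j,−}(α,φ)] : α > 0, φ ∈ F}`. -/
noncomputable def OptIJ (i j : ι) : ℝ :=
  sInf {v | ∃ α : ℝ, 0 < α ∧ ∃ φ ∈ O.F,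
    v = (1 / 2) * (PsiPlus O X A g ε K i α φ + PsiMinus O X A g ε K j α φ)}

/-- `Opt(K) = max_{i,j} Opt_{ij}(K)`. -/
noncomputable def OptTotal : ℝ :=
  Finset.univ.sup' Finset.univ_nonempty fun q : ι × ι => OptIJ O X A g ε K q.1 q.2

/-- The minimax `ε`-risk `Risk*_ε(K̄)`: the infimum, over Borel estimates `ĝ` based on
`K̄` i.i.d. observations, of the worst-case `(ρ,ε)`-reliability level. -/
noncomputable def RiskStar (Kb : ℕ) : ℝ :=
  sInf {ρ : ℝ | ∃ ghat : (Fin Kb → Ω) → ℝ, Measurable ghat ∧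
    ∀ j : ι, ∀ x ∈ X j,
      prodDensityMeasure O.P Kb (O.p (A j x))
        {y | ρ < |ghat y - ∑ i, g i * x i|} ≤ ENNReal.ofReal ε}

end LinearProblem

/-- A minimax theorem of Kneser–Fan type: no topology is needed on the index set of the
functions being minimised. -/
lemma exists_forall_le_of_forall_exists_lt {E Y : Type*} [AddCommGroup E] [Module ℝ E]
    [TopologicalSpace E] {s : Set E} (hs : IsCompact s) (hconv : Convex ℝ s)
    (hne : s.Nonempty) {f : Y → E → ℝ} (hconc : ∀ y, ConcaveOn ℝ s (f y))
    (hcont : ∀ y, ContinuousOn (f y) s)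
    (hmix : ∀ (t : Finset Y) (w : Y → ℝ), (∀ y ∈ t, 0 ≤ w y) → ∑ y ∈ t, w y = 1 →
      ∃ y₀, ∀ x ∈ s, f y₀ x ≤ ∑ y ∈ t, w y * f y x)
    {c : ℝ} (h : ∀ x ∈ s, ∃ y, f y x < c) : ∃ y₀, ∀ x ∈ s, f y₀ x ≤ c := by
  classical
  obtain ⟨y₁, -⟩ := h _ hne.some_mem
  have : Nonempty Y := ⟨y₁⟩
  choose! y hy using h
  obtain ⟨u, -, hu⟩ := hs.elim_nhdsWithin_subcover (fun x => {z | f (y x) z < c})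
    fun x hx => (hcont (y x) x hx).eventually (gt_mem_nhds (hy x hx))
  set t : Finset Y := u.image y
  have hcover : ∀ x ∈ s, ∃ k : t, f k x < c := by
    intro x hx
    obtain ⟨z, hz, hzx⟩ := Set.mem_iUnion₂.1 (hu hx)
    exact ⟨⟨y z, Finset.mem_image_of_mem y hz⟩, hzx⟩
  set S : Set (t → ℝ) := {z | ∃ x ∈ s, ∀ k : t, z k < f k x}
  set T : Set (t → ℝ) := {z | ∀ k, c ≤ z k}
  have hSconv : Convex ℝ S := by
    rintro z ⟨x, hx, hz⟩ z' ⟨x', hx', hz'⟩ a b ha hb hab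
    refine ⟨a • x + b • x', hconv hx hx' ha hb hab, fun k => ?_⟩
    refine lt_of_lt_of_le ?_ ((hconc k).2 hx hx' ha hb hab)
    simp only [Pi.add_apply, Pi.smul_apply, smul_eq_mul]
    rcases ha.eq_or_lt with rfl | ha'
    · obtain rfl : b = 1 := by linarith
      simpa using hz' k
    · have h1 := mul_lt_mul_of_pos_left (hz k) ha'
      have h2 := mul_le_mul_of_nonneg_left (hz' k).le hb
      linarith
  have hSopen : IsOpen S := by
    have : S = ⋃ x ∈ s, ⋂ k : t, {z : t → ℝ | z k < f k x} := by
      ext z; simp [S]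
    rw [this]
    exact isOpen_biUnion fun x _ => isOpen_iInter_of_finite fun k =>
      isOpen_lt (continuous_apply k) continuous_const
  have hTconv : Convex ℝ T := by
    intro z hz z' hz' a b ha hb hab k
    have h1 := mul_le_mul_of_nonneg_left (hz k) ha
    have h2 := mul_le_mul_of_nonneg_left (hz' k) hb
    simp only [Pi.add_apply, Pi.smul_apply, smul_eq_mul]
    have h3 : a * c + b * c = c := by rw [← add_mul, hab, one_mul]
    linarith
  have hdisj : Disjoint S T := by
    rw [Set.disjoint_left]
    rintro z ⟨x, hx, hz⟩ hT
    obtain ⟨k, hk⟩ := hcover x hx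
    linarith [hz k, hT k]
  obtain ⟨l, r, hlS, hlT⟩ := geometric_hahn_banach_open hSconv hSopen hTconv hdisj
  set v : t → ℝ := fun k => l (Pi.single k 1)
  have hl : ∀ z, l z = ∑ k, v k * z k := by
    intro z
    conv_lhs => rw [← Finset.univ_sum_single z]
    rw [map_sum]
    refine Finset.sum_congr rfl fun k _ => ?_
    have : (Pi.single k (z k) : t → ℝ) = z k • Pi.single k 1 := by
      rw [← Pi.single_smul]; simp
    rw [this, map_smul, smul_eq_mul, mul_comm]
  have hv : ∀ k, 0 ≤ v k := by
    intro k
    by_contra! hk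
    have key : ∀ M : ℝ, 0 ≤ M → r ≤ l (fun _ => c) + M * v k := by
      intro M hM
      have := hlT ((fun _ => c) + M • Pi.single k 1) (fun j => by
        simp only [Pi.add_apply, Pi.smul_apply, smul_eq_mul]
        have : 0 ≤ M * (Pi.single k (1 : ℝ) : t → ℝ) j := by
          refine mul_nonneg hM ?_
          by_cases hj : j = k
          · subst hj; simp
          · simp [hj]
        linarith)
      simpa [map_add, map_smul] using this
    have h0 := key 0 le_rfl
    have h1 := key ((l (fun _ => c) - r + 1) / (-v k))
      (div_nonneg (by linarith) (by linarith))
    rw [div_mul_eq_mul_div, div_neg, mul_div_assoc, div_self hk.ne] at h1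
    linarith
  have hV : 0 < ∑ k, v k := by
    refine lt_of_le_of_ne (Finset.sum_nonneg fun k _ => hv k) fun h0 => ?_
    have hv0 : ∀ k, v k = 0 := fun k =>
      (Finset.sum_eq_zero_iff_of_nonneg fun k _ => hv k).1 h0.symm k (Finset.mem_univ k)
    have hl0 : ∀ z, l z = 0 := fun z => by simp [hl, hv0]
    have h1 := hlS (fun k => f k hne.some - 1) ⟨_, hne.some_mem, fun k => by linarith⟩
    have h2 := hlT (fun _ => c) fun _ => le_rfl
    rw [hl0] at h1 h2
    linarith
  have hbound : ∀ x ∈ s, ∑ k : t, v k * f k x ≤ c * ∑ k, v k := by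
    intro x hx
    refine le_of_forall_pos_le_add fun δ hδ => ?_
    have h1 := hlS (fun k => f k x - δ / ∑ k, v k)
      ⟨x, hx, fun k => by linarith [div_pos hδ hV]⟩
    have h2 := hlT (fun _ => c) fun _ => le_rfl
    rw [hl] at h1 h2
    simp only [mul_sub, Finset.sum_sub_distrib, ← Finset.sum_mul] at h1 h2
    rw [mul_div_cancel₀ _ hV.ne'] at h1
    linarith
  set w : Y → ℝ := fun y => if hy : y ∈ t then v ⟨y, hy⟩ / ∑ k, v k else 0
  have hw : ∀ k : t, w k = v k / ∑ k, v k := fun k => by simp [w]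
  have hsum : ∀ a : Y → ℝ, ∑ y ∈ t, w y * a y = (∑ k : t, v k * a k) / ∑ k, v k := by
    intro a
    rw [← Finset.sum_coe_sort, Finset.sum_div]
    exact Finset.sum_congr rfl fun k _ => by rw [hw]; ring
  obtain ⟨y₀, hy₀⟩ := hmix t w
    (fun y hy => by rw [hw ⟨y, hy⟩]; exact div_nonneg (hv _) hV.le)
    (by
      have := hsum fun _ => 1
      simp only [mul_one] at this
      rw [this, div_self hV.ne'])
  refine ⟨y₀, fun x hx => (hy₀ x hx).trans ?_⟩
  rw [hsum, div_le_iff₀ hV]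
  exact hbound x hx

/-- Two probability densities separated by a test with both error probabilities at most `ε`
have Hellinger affinity at most `2√(ε(1-ε))`. -/
lemma sq_integral_sqrt_mul_le {Y : Type*} [MeasurableSpace Y] {Q : Measure Y} {p q : Y → ℝ}
    (hp : ∀ y, 0 ≤ p y) (hq : ∀ y, 0 ≤ q y) (hpi : Integrable p Q) (hqi : Integrable q Q)
    (hp1 : ∫ y, p y ∂Q = 1) (hq1 : ∫ y, q y ∂Q = 1) {B : Set Y} (hB : MeasurableSet B)
    {ε : ℝ} (hε : ε ≤ 1 / 2) (hpB : ∫ y in B, p y ∂Q ≤ ε) (hqB : ∫ y in Bᶜ, q y ∂Q ≤ ε)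
    (hpos : 0 < ∫ y, √(p y * q y) ∂Q) :
    (∫ y, √(p y * q y) ∂Q) ^ 2 ≤ 4 * ε * (1 - ε) := by
  set a := ∫ y, √(p y * q y) ∂Q with ha
  have hsi : Integrable (fun y => √(p y * q y)) Q := by
    by_contra hn
    rw [ha, integral_undef hn] at hpos
    exact lt_irrefl _ hpos
  have hmi : Integrable (fun y => min (p y) (q y)) Q := hpi.inf hqi
  set s := ∫ y, min (p y) (q y) ∂Q with hs
  have hs2 : s ≤ 2 * ε := by
    have h1 : ∫ y in B, min (p y) (q y) ∂Q ≤ ∫ y in B, p y ∂Q :=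
      integral_mono hmi.integrableOn hpi.integrableOn fun y => min_le_left _ _
    have h2 : ∫ y in Bᶜ, min (p y) (q y) ∂Q ≤ ∫ y in Bᶜ, q y ∂Q :=
      integral_mono hmi.integrableOn hqi.integrableOn fun y => min_le_right _ _
    have h3 := integral_add_compl hB hmi
    linarith
  have hlam : 0 < (2 - s) / a := div_pos (by linarith) hpos
  set lam := (2 - s) / a with hlamdef
  have hpt : ∀ y, 2 * √(p y * q y) ≤
      lam * min (p y) (q y) + lam⁻¹ * (p y + q y - min (p y) (q y)) := by
    intro y
    have hmm : p y * q y = min (p y) (q y) * (p y + q y - min (p y) (q y)) := by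
      rcases le_total (p y) (q y) with h | h
      · rw [min_eq_left h]; ring
      · rw [min_eq_right h]; ring
    have hm : 0 ≤ min (p y) (q y) := le_min (hp y) (hq y)
    have hM : 0 ≤ p y + q y - min (p y) (q y) := by
      linarith [min_le_left (p y) (q y), hq y]
    have hrw : p y * q y =
        (lam * min (p y) (q y)) * (lam⁻¹ * (p y + q y - min (p y) (q y))) := by
      rw [hmm]; field_simp
    have h1 := mul_nonneg hlam.le hm
    have h2 := mul_nonneg (inv_nonneg.2 hlam.le) hM
    rw [hrw, Real.sqrt_mul h1]
    nlinarith [sq_nonneg (√(lam * min (p y) (q y)) -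
      √(lam⁻¹ * (p y + q y - min (p y) (q y)))), Real.sq_sqrt h1, Real.sq_sqrt h2]
  have hInt : 2 * a ≤ lam * s + lam⁻¹ * (2 - s) := by
    have hpq : Integrable (fun y => p y + q y) Q := hpi.add hqi
    have hM : Integrable (fun y => p y + q y - min (p y) (q y)) Q := hpq.sub hmi
    have := integral_mono (hsi.const_mul 2) ((hmi.const_mul lam).add (hM.const_mul lam⁻¹)) hpt
    simp only [Pi.add_apply] at this
    rw [integral_add (hmi.const_mul lam) (hM.const_mul lam⁻¹), integral_const_mul,
      integral_const_mul, integral_const_mul, integral_sub hpq hmi,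
      integral_add hpi hqi, hp1, hq1] at this
    norm_num at this
    linarith
  have h2 : lam⁻¹ * (2 - s) = a := by
    rw [hlamdef, inv_div, div_mul_cancel₀]; linarith
  rw [h2, hlamdef, div_mul_eq_mul_div] at hInt
  have h3 : a * a ≤ (2 - s) * s := by
    have : a ≤ (2 - s) * s / a := by linarith
    rwa [le_div_iff₀ hpos] at this
  nlinarith

section Phi

variable {Ω : Type} [TopologicalSpace Ω] [PolishSpace Ω] [MeasurableSpace Ω] [BorelSpace Ω]
  {m n : ℕ} (O : GoodOS Ω m)

lemma GoodOS.integral_exp_mul_eq_exp_Phi {φ : Ω → ℝ} (hφ : φ ∈ O.F) {μ : Fin m → ℝ}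
    (hμ : μ ∈ O.M) : ∫ ω, Real.exp (φ ω) * O.p μ ω ∂O.P = Real.exp (O.Phi φ μ) :=
  (Real.exp_log (O.mgf_pos φ hφ μ hμ)).symm

lemma GoodOS.Phi_zero {μ : Fin m → ℝ} (hμ : μ ∈ O.M) : O.Phi (fun _ => 0) μ = 0 := by
  simp [GoodOS.Phi, O.p_prob μ hμ]

/-- Jensen's inequality for the log-moment generating function. -/
lemma GoodOS.Phi_sum_le {Y : Type*} (t : Finset Y) {w : Y → ℝ} (hw : ∀ k ∈ t, 0 ≤ w k)
    (hw1 : ∑ k ∈ t, w k = 1) {φ : Y → Ω → ℝ} (hφ : ∀ k ∈ t, φ k ∈ O.F) {μ : Fin m → ℝ}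
    (hμ : μ ∈ O.M) :
    O.Phi (fun ω => ∑ k ∈ t, w k * φ k ω) μ ≤ ∑ k ∈ t, w k * O.Phi (φ k) μ := by
  set Z := ∑ k ∈ t, w k * O.Phi (φ k) μ
  have hmem : (fun ω => ∑ k ∈ t, w k * φ k ω) ∈ O.F := by
    have : (fun ω => ∑ k ∈ t, w k * φ k ω) = ∑ k ∈ t, w k • φ k := by
      ext ω; simp
    rw [this]
    exact Submodule.sum_mem _ fun k hk => O.F.smul_mem _ (hφ k hk)
  have hpt : ∀ ω, Real.exp (∑ k ∈ t, w k * φ k ω) * O.p μ ω ≤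
      Real.exp Z * ∑ k ∈ t, w k * Real.exp (-O.Phi (φ k) μ) *
        (Real.exp (φ k ω) * O.p μ ω) := by
    intro ω
    have h := convexOn_exp.map_sum_le (p := fun k => φ k ω - O.Phi (φ k) μ) hw hw1
      fun _ _ => Set.mem_univ _
    simp only [smul_eq_mul, mul_sub, Finset.sum_sub_distrib] at h
    have h' : Real.exp (∑ k ∈ t, w k * φ k ω) ≤
        Real.exp Z * ∑ k ∈ t, w k * Real.exp (φ k ω - O.Phi (φ k) μ) := by
      calc _ = Real.exp Z * Real.exp (∑ k ∈ t, w k * φ k ω - Z) := by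
            rw [← Real.exp_add]; ring_nf
        _ ≤ _ := mul_le_mul_of_nonneg_left h (Real.exp_pos _).le
    refine (mul_le_mul_of_nonneg_right h' (O.p_pos μ hμ ω).le).trans_eq ?_
    rw [mul_assoc, Finset.sum_mul]
    congr 1
    refine Finset.sum_congr rfl fun k _ => ?_
    rw [sub_eq_add_neg, Real.exp_add]
    ring
  have hInt : ∀ k ∈ t, Integrable (fun ω => w k * Real.exp (-O.Phi (φ k) μ) *
      (Real.exp (φ k ω) * O.p μ ω)) O.P := fun k hk =>
    (O.mgf_integrable _ (hφ k hk) μ hμ).const_mul _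
  have h := integral_mono (O.mgf_integrable _ hmem μ hμ)
    ((integrable_finsetSum t hInt).const_mul (Real.exp Z)) hpt
  rw [O.integral_exp_mul_eq_exp_Phi hmem hμ, integral_const_mul,
    integral_finsetSum t hInt] at h
  have h1 : ∑ k ∈ t, ∫ ω, w k * Real.exp (-O.Phi (φ k) μ) *
      (Real.exp (φ k ω) * O.p μ ω) ∂O.P = 1 := by
    rw [← hw1]
    refine Finset.sum_congr rfl fun k hk => ?_
    rw [integral_const_mul, O.integral_exp_mul_eq_exp_Phi (hφ k hk) hμ, mul_assoc,
      ← Real.exp_add]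
    simp
  rw [h1, mul_one] at h
  exact Real.exp_le_exp.1 h

lemma GoodOS.neg_mem {φ : Ω → ℝ} (hφ : φ ∈ O.F) : (fun ω => -φ ω) ∈ O.F :=
  O.F.neg_mem hφ

lemma GoodOS.div_mem {φ : Ω → ℝ} (hφ : φ ∈ O.F) (a : ℝ) : (fun ω => φ ω / a) ∈ O.F := by
  simp only [div_eq_inv_mul]
  exact O.F.smul_mem a⁻¹ hφ

/-- The perspective of the log-moment generating function is convex. -/
lemma GoodOS.perspective_Phi_sum_le {Y : Type*} (t : Finset Y) {w α : Y → ℝ}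
    (hw : ∀ k ∈ t, 0 ≤ w k) (hα : ∀ k ∈ t, 0 < α k) (hpos : 0 < ∑ k ∈ t, w k * α k)
    {φ : Y → Ω → ℝ} (hφ : ∀ k ∈ t, φ k ∈ O.F) {μ : Fin m → ℝ} (hμ : μ ∈ O.M) :
    (∑ k ∈ t, w k * α k) * O.Phi (fun ω => (∑ k ∈ t, w k * φ k ω) / ∑ k ∈ t, w k * α k) μ ≤
      ∑ k ∈ t, w k * (α k * O.Phi (fun ω => φ k ω / α k) μ) := by
  set a := ∑ k ∈ t, w k * α k with ha
  have h := O.Phi_sum_le t (w := fun k => w k * α k / a) (φ := fun k ω => φ k ω / α k)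
    (fun k hk => div_nonneg (mul_nonneg (hw k hk) (hα k hk).le) hpos.le)
    (by rw [← Finset.sum_div, ← ha, div_self hpos.ne']) (fun k hk => O.div_mem (hφ k hk) _) hμ
  have hfun : (fun ω => (∑ k ∈ t, w k * φ k ω) / a) =
      fun ω => ∑ k ∈ t, w k * α k / a * (φ k ω / α k) := by
    ext ω
    rw [Finset.sum_div]
    refine Finset.sum_congr rfl fun k hk => ?_
    have := (hα k hk).ne'
    field_simp
  rw [hfun]
  refine (mul_le_mul_of_nonneg_left h hpos.le).trans_eq ?_
  rw [Finset.mul_sum]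
  refine Finset.sum_congr rfl fun k _ => ?_
  field_simp

lemma GoodOS.Phi_add_Phi_neg_nonneg {φ : Ω → ℝ} (hφ : φ ∈ O.F) {μ : Fin m → ℝ}
    (hμ : μ ∈ O.M) : 0 ≤ O.Phi φ μ + O.Phi (fun ω => -φ ω) μ := by
  have h := O.Phi_sum_le (Finset.univ : Finset Bool) (w := fun _ => 1 / 2)
    (φ := fun b ω => if b then φ ω else -φ ω) (by norm_num) (by norm_num)
    (by rintro (_ | _) -; exacts [by simpa using O.neg_mem hφ, by simpa using hφ]) hμ
  have h0 : (fun ω => ∑ b : Bool, 1 / 2 * (if b then φ ω else -φ ω)) = fun _ => 0 := by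
    ext ω; simp
  rw [h0, O.Phi_zero hμ] at h
  simp only [Fintype.sum_bool, if_true, Bool.false_eq_true, if_false] at h
  linarith

lemma GoodOS.continuousOn_Phi {φ : Ω → ℝ} (hφ : φ ∈ O.F) : ContinuousOn (O.Phi φ) O.M := by
  rcases O.M.eq_empty_or_nonempty with h | ⟨μ₀, hμ₀⟩
  · simp [h]
  set V := (affineSpan ℝ O.M).direction
  have hμ₀' : μ₀ ∈ affineSpan ℝ O.M := subset_affineSpan ℝ _ hμ₀
  set τ : V →ᵃ[ℝ] (Fin m → ℝ) := V.subtype.toAffineMap + AffineMap.const ℝ V μ₀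
  have hτ : ∀ v : V, τ v = v + μ₀ := fun v => rfl
  have hτc : Continuous τ := by
    change Continuous fun v : V => (v : Fin m → ℝ) + μ₀
    fun_prop
  have hmem : ∀ v : V, τ v ∈ affineSpan ℝ O.M := fun v =>
    AffineSubspace.vadd_mem_of_mem_direction v.2 hμ₀'
  have hopen : IsOpen (τ ⁻¹' O.M) := by
    have : τ ⁻¹' O.M = (fun v => (⟨τ v, hmem v⟩ : affineSpan ℝ O.M)) ⁻¹'
      (Subtype.val ⁻¹' O.M) := rfl
    rw [this]
    exact O.M_relatively_open.preimage (hτc.subtype_mk _)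
  have hconc : ConcaveOn ℝ (τ ⁻¹' O.M) (O.Phi φ ∘ τ) :=
    (O.mgf_concave φ hφ).comp_affineMap τ
  have hc := hconc.continuousOn hopen
  rw [continuousOn_iff_continuous_domRestrict]
  have hdir : ∀ μ : O.M, (μ : Fin m → ℝ) - μ₀ ∈ V := fun μ =>
    AffineSubspace.vsub_mem_direction (subset_affineSpan ℝ _ μ.2) hμ₀'
  have hσ : Continuous fun μ : O.M => (⟨(μ : Fin m → ℝ) - μ₀, hdir μ⟩ : V) := by
    refine Continuous.subtype_mk ?_ _
    fun_prop
  have hτσ : ∀ μ : O.M, τ ⟨(μ : Fin m → ℝ) - μ₀, hdir μ⟩ = μ := fun μ => by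
    rw [hτ]; exact sub_add_cancel _ _
  have := hc.comp_continuous hσ fun μ => by
    change τ _ ∈ O.M
    rw [hτσ]; exact μ.2
  refine this.congr fun μ => ?_
  simp [hτσ]

lemma GoodOS.concaveOn_Phi_comp {X : Set (Fin n → ℝ)} (hX : Convex ℝ X)
    {A : (Fin n → ℝ) →ᵃ[ℝ] (Fin m → ℝ)} (hA : ∀ x ∈ X, A x ∈ O.M) {φ : Ω → ℝ}
    (hφ : φ ∈ O.F) : ConcaveOn ℝ X fun x => O.Phi φ (A x) :=
  ((O.mgf_concave φ hφ).comp_affineMap A).subset hA hX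

lemma GoodOS.continuousOn_Phi_comp {X : Set (Fin n → ℝ)}
    {A : (Fin n → ℝ) →ᵃ[ℝ] (Fin m → ℝ)} (hA : ∀ x ∈ X, A x ∈ O.M) {φ : Ω → ℝ}
    (hφ : φ ∈ O.F) : ContinuousOn (fun x => O.Phi φ (A x)) X :=
  (O.continuousOn_Phi hφ).comp A.continuous_of_finiteDimensional.continuousOn hA

end Phi

section SaddlePoint

variable {Ω : Type} [TopologicalSpace Ω] [PolishSpace Ω] [MeasurableSpace Ω] [BorelSpace Ω]
  {m n : ℕ} {ι : Type} [Fintype ι] (O : GoodOS Ω m)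
  (X : ι → Set (Fin n → ℝ)) (A : ι → (Fin n → ℝ) →ᵃ[ℝ] (Fin m → ℝ)) (g : Fin n → ℝ) (ε : ℝ)
  (K : ℕ)

lemma sum_mul_combo (x y : Fin n → ℝ) (a b : ℝ) :
    ∑ i, g i * (a • x + b • y) i = a * ∑ i, g i * x i + b * ∑ i, g i * y i := by
  simp only [Pi.add_apply, Pi.smul_apply, smul_eq_mul, mul_add, Finset.sum_add_distrib,
    Finset.mul_sum, mul_left_comm]

/-- The function whose maximum over `x ∈ X i` is `PsiPlus`. -/
noncomputable def psiPlusFun (i : ι) (β : ℝ) (ψ : Ω → ℝ) (x : Fin n → ℝ) : ℝ :=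
  (K : ℝ) * β * O.Phi (fun ω => ψ ω / β) (A i x)
    - (∑ i, g i * x i) + β * Real.log (2 * (Fintype.card ι : ℝ) / ε)

/-- The function whose maximum over `x ∈ X j` is `PsiMinus`. -/
noncomputable def psiMinusFun (j : ι) (β : ℝ) (ψ : Ω → ℝ) (x : Fin n → ℝ) : ℝ :=
  (K : ℝ) * β * O.Phi (fun ω => -ψ ω / β) (A j x)
    + (∑ i, g i * x i) + β * Real.log (2 * (Fintype.card ι : ℝ) / ε)

variable {O X A}

lemma continuousOn_psiPlusFun {i : ι} (hA : ∀ x ∈ X i, A i x ∈ O.M) (β : ℝ) {ψ : Ω → ℝ}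
    (hψ : ψ ∈ O.F) : ContinuousOn (psiPlusFun O A g ε K i β ψ) (X i) := by
  have := O.continuousOn_Phi_comp hA (O.div_mem hψ β)
  unfold psiPlusFun
  fun_prop

lemma continuousOn_psiMinusFun {j : ι} (hA : ∀ x ∈ X j, A j x ∈ O.M) (β : ℝ) {ψ : Ω → ℝ}
    (hψ : ψ ∈ O.F) : ContinuousOn (psiMinusFun O A g ε K j β ψ) (X j) := by
  have := O.continuousOn_Phi_comp hA (O.div_mem (O.neg_mem hψ) β)
  unfold psiMinusFun
  fun_prop

lemma concaveOn_psiPlusFun {i : ι} (hX : Convex ℝ (X i)) (hA : ∀ x ∈ X i, A i x ∈ O.M)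
    {β : ℝ} (hβ : 0 ≤ β) {ψ : Ω → ℝ} (hψ : ψ ∈ O.F) :
    ConcaveOn ℝ (X i) (psiPlusFun O A g ε K i β ψ) := by
  refine ⟨hX, fun x hx y hy a b ha hb hab => ?_⟩
  have h := (O.concaveOn_Phi_comp hX hA (O.div_mem hψ β)).2 hx hy ha hb hab
  have h' := mul_le_mul_of_nonneg_left h (mul_nonneg (Nat.cast_nonneg (α := ℝ) K) hβ)
  obtain rfl : b = 1 - a := by linarith
  simp only [psiPlusFun, sum_mul_combo, smul_eq_mul] at h' ⊢
  linarith

lemma concaveOn_psiMinusFun {j : ι} (hX : Convex ℝ (X j)) (hA : ∀ x ∈ X j, A j x ∈ O.M)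
    {β : ℝ} (hβ : 0 ≤ β) {ψ : Ω → ℝ} (hψ : ψ ∈ O.F) :
    ConcaveOn ℝ (X j) (psiMinusFun O A g ε K j β ψ) := by
  refine ⟨hX, fun x hx y hy a b ha hb hab => ?_⟩
  have h := (O.concaveOn_Phi_comp hX hA (O.div_mem (O.neg_mem hψ) β)).2 hx hy ha hb hab
  have h' := mul_le_mul_of_nonneg_left h (mul_nonneg (Nat.cast_nonneg (α := ℝ) K) hβ)
  obtain rfl : b = 1 - a := by linarith
  simp only [psiMinusFun, sum_mul_combo, smul_eq_mul] at h' ⊢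
  linarith

lemma le_PsiPlus {i : ι} (hX : IsCompact (X i)) (hA : ∀ x ∈ X i, A i x ∈ O.M) (β : ℝ)
    {ψ : Ω → ℝ} (hψ : ψ ∈ O.F) {x : Fin n → ℝ} (hx : x ∈ X i) :
    psiPlusFun O A g ε K i β ψ x ≤ PsiPlus O X A g ε K i β ψ := by
  refine le_csSup ?_ ⟨x, hx, rfl⟩
  refine (hX.bddAbove_image (continuousOn_psiPlusFun g ε K hA β hψ)).mono ?_
  rintro _ ⟨z, hz, rfl⟩
  exact ⟨z, hz, rfl⟩

lemma le_PsiMinus {j : ι} (hX : IsCompact (X j)) (hA : ∀ x ∈ X j, A j x ∈ O.M) (β : ℝ)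
    {ψ : Ω → ℝ} (hψ : ψ ∈ O.F) {x : Fin n → ℝ} (hx : x ∈ X j) :
    psiMinusFun O A g ε K j β ψ x ≤ PsiMinus O X A g ε K j β ψ := by
  refine le_csSup ?_ ⟨x, hx, rfl⟩
  refine (hX.bddAbove_image (continuousOn_psiMinusFun g ε K hA β hψ)).mono ?_
  rintro _ ⟨z, hz, rfl⟩
  exact ⟨z, hz, rfl⟩

lemma PsiPlus_add_PsiMinus_le {i j : ι} (hi : (X i).Nonempty) (hj : (X j).Nonempty) {β c : ℝ}
    {ψ : Ω → ℝ} (h : ∀ x ∈ X i, ∀ y ∈ X j,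
      psiPlusFun O A g ε K i β ψ x + psiMinusFun O A g ε K j β ψ y ≤ c) :
    PsiPlus O X A g ε K i β ψ + PsiMinus O X A g ε K j β ψ ≤ c := by
  suffices PsiMinus O X A g ε K j β ψ ≤ c - PsiPlus O X A g ε K i β ψ by linarith
  obtain ⟨x₀, hx₀⟩ := hi
  obtain ⟨y₀, hy₀⟩ := hj
  refine csSup_le ⟨_, y₀, hy₀, rfl⟩ ?_
  rintro _ ⟨y, hy, rfl⟩
  change psiMinusFun O A g ε K j β ψ y ≤ _
  suffices PsiPlus O X A g ε K i β ψ ≤ c - psiMinusFun O A g ε K j β ψ y by linarith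
  refine csSup_le ⟨_, x₀, hx₀, rfl⟩ ?_
  rintro _ ⟨x, hx, rfl⟩
  change psiPlusFun O A g ε K i β ψ x ≤ _
  linarith [h x hx y hy]

lemma bddBelow_OptIJ_set {i j : ι} (hXi : IsCompact (X i)) (hXj : IsCompact (X j))
    (hAi : ∀ x ∈ X i, A i x ∈ O.M) (hAj : ∀ x ∈ X j, A j x ∈ O.M)
    (hcommon : ∃ xbar, xbar ∈ X i ∩ X j ∧ A i xbar = A j xbar)
    (hL : 0 ≤ Real.log (2 * (Fintype.card ι : ℝ) / ε)) :
    BddBelow {v | ∃ α : ℝ, 0 < α ∧ ∃ φ ∈ O.F,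
      v = (1 / 2) * (PsiPlus O X A g ε K i α φ + PsiMinus O X A g ε K j α φ)} := by
  refine ⟨0, ?_⟩
  rintro _ ⟨α, hα, φ, hφ, rfl⟩
  obtain ⟨x, ⟨hxi, hxj⟩, hx⟩ := hcommon
  have h1 := le_PsiPlus g ε K hXi hAi α hφ hxi
  have h2 := le_PsiMinus g ε K hXj hAj α hφ hxj
  have h3 := mul_nonneg (mul_nonneg (Nat.cast_nonneg (α := ℝ) K) hα.le)
    (O.Phi_add_Phi_neg_nonneg (O.div_mem hφ α) (hAi x hxi))
  have h4 := mul_nonneg hα.le hL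
  simp only [psiPlusFun, psiMinusFun, ← hx, neg_div] at h1 h2
  linarith

/-- A near-saddle point of the problem defining `OptIJ`: a pair of signals whose values of the
linear form are far apart while their distributions are hard to distinguish. -/
lemma exists_pair_of_lt_OptIJ {i j : ι} (hXi : IsCompact (X i)) (hXj : IsCompact (X j))
    (hci : Convex ℝ (X i)) (hcj : Convex ℝ (X j))
    (hAi : ∀ x ∈ X i, A i x ∈ O.M) (hAj : ∀ x ∈ X j, A j x ∈ O.M)
    (hcommon : ∃ xbar, xbar ∈ X i ∩ X j ∧ A i xbar = A j xbar)
    (hL : 0 ≤ Real.log (2 * (Fintype.card ι : ℝ) / ε)) {c : ℝ}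
    (hc : c < OptIJ O X A g ε K i j) :
    ∃ x ∈ X i, ∃ y ∈ X j, 2 * c ≤ (∑ k, g k * y k) - ∑ k, g k * x k ∧
      ∀ ψ ∈ O.F, 0 ≤ (K : ℝ) * (O.Phi ψ (A i x) + O.Phi (fun ω => -ψ ω) (A j y)) +
        2 * Real.log (2 * (Fintype.card ι : ℝ) / ε) := by
  set L := Real.log (2 * (Fintype.card ι : ℝ) / ε) with hLdef
  obtain ⟨xbar, ⟨hbi, hbj⟩, -⟩ := id hcommon
  let Y := {q : ℝ × (Ω → ℝ) // 0 < q.1 ∧ q.2 ∈ O.F}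
  let f : Y → (Fin n → ℝ) × (Fin n → ℝ) → ℝ := fun q z =>
    psiPlusFun O A g ε K i q.1.1 q.1.2 z.1 + psiMinusFun O A g ε K j q.1.1 q.1.2 z.2
  have hs : Convex ℝ (X i ×ˢ X j) := hci.prod hcj
  have hpair : ∃ z ∈ X i ×ˢ X j, ∀ q, 2 * c ≤ f q z := by
    by_contra! hcon
    obtain ⟨q, hq⟩ := exists_forall_le_of_forall_exists_lt (hXi.prod hXj) hs
      ⟨(xbar, xbar), hbi, hbj⟩ (f := f) (c := 2 * c)
      (fun q => by
        have h1 := (concaveOn_psiPlusFun g ε K hci hAi q.2.1.le q.2.2).comp_linearMap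
          (LinearMap.fst ℝ (Fin n → ℝ) (Fin n → ℝ))
        have h2 := (concaveOn_psiMinusFun g ε K hcj hAj q.2.1.le q.2.2).comp_linearMap
          (LinearMap.snd ℝ (Fin n → ℝ) (Fin n → ℝ))
        exact (h1.subset (fun z hz => hz.1) hs).add (h2.subset (fun z hz => hz.2) hs))
      (fun q => by
        refine ContinuousOn.add ?_ ?_
        · exact (continuousOn_psiPlusFun g ε K hAi q.1.1 q.2.2).comp
            continuous_fst.continuousOn fun z hz => hz.1
        · exact (continuousOn_psiMinusFun g ε K hAj q.1.1 q.2.2).comp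
            continuous_snd.continuousOn fun z hz => hz.2)
      (fun t w hw hw1 => by
        have hpos : 0 < ∑ q ∈ t, w q * q.1.1 := by
          refine lt_of_le_of_ne
            (Finset.sum_nonneg fun q hq => mul_nonneg (hw q hq) q.2.1.le) fun h0 => ?_
          have hz := (Finset.sum_eq_zero_iff_of_nonneg
            fun q hq => mul_nonneg (hw q hq) q.2.1.le).1 h0.symm
          have : ∑ q ∈ t, w q = 0 := Finset.sum_eq_zero fun q hq =>
            (mul_eq_zero.1 (hz q hq)).resolve_right q.2.1.ne'
          linarith
        have hmem : (fun ω => ∑ q ∈ t, w q * q.1.2 ω) ∈ O.F := by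
          have : (fun ω => ∑ q ∈ t, w q * q.1.2 ω) = ∑ q ∈ t, w q • q.1.2 := by
            ext ω; simp
          rw [this]
          exact Submodule.sum_mem _ fun q _ => O.F.smul_mem _ q.2.2
        refine ⟨⟨(∑ q ∈ t, w q * q.1.1, fun ω => ∑ q ∈ t, w q * q.1.2 ω), hpos, hmem⟩,
          fun z hz => ?_⟩
        have h1 := O.perspective_Phi_sum_le t hw (fun q _ => q.2.1) hpos
          (φ := fun q => q.1.2) (fun q _ => q.2.2) (hAi z.1 hz.1)
        have h2 := O.perspective_Phi_sum_le t hw (fun q _ => q.2.1) hpos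
          (φ := fun q ω => -q.1.2 ω) (fun q _ => O.neg_mem q.2.2) (hAj z.2 hz.2)
        have h3 := mul_le_mul_of_nonneg_left (add_le_add h1 h2)
          (Nat.cast_nonneg (α := ℝ) K)
        have hG : ∀ G : ℝ, ∑ q ∈ t, w q * G = G := fun G => by
          rw [← Finset.sum_mul, hw1, one_mul]
        have hG' := hG ((∑ k, g k * z.2 k) - ∑ k, g k * z.1 k)
        simp only [f, psiPlusFun, psiMinusFun, ← hLdef]
        simp only [mul_neg, Finset.sum_neg_distrib] at h3
        calc _ = K * ((∑ q ∈ t, w q * q.1.1) *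
                O.Phi (fun ω => (∑ q ∈ t, w q * q.1.2 ω) / ∑ q ∈ t, w q * q.1.1) (A i z.1) +
              (∑ q ∈ t, w q * q.1.1) *
                O.Phi (fun ω => (-∑ q ∈ t, w q * q.1.2 ω) / ∑ q ∈ t, w q * q.1.1) (A j z.2)) +
              ((∑ k, g k * z.2 k) - ∑ k, g k * z.1 k) + 2 * (∑ q ∈ t, w q * q.1.1) * L := by
              ring
          _ ≤ _ := add_le_add_left (add_le_add_left h3 _) _
          _ = _ := by
              conv_lhs => rw [← hG']
              rw [← Finset.sum_add_distrib, Finset.mul_sum, Finset.mul_sum, Finset.sum_mul,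
                ← Finset.sum_add_distrib, ← Finset.sum_add_distrib]
              exact Finset.sum_congr rfl fun q _ => by ring)
      (fun z hz => hcon z hz)
    have h1 := PsiPlus_add_PsiMinus_le g ε K ⟨xbar, hbi⟩ ⟨xbar, hbj⟩
      fun x hx y hy => hq (x, y) ⟨hx, hy⟩
    have h2 : OptIJ O X A g ε K i j ≤ _ :=
      csInf_le (bddBelow_OptIJ_set g ε K hXi hXj hAi hAj hcommon hL)
        ⟨q.1.1, q.2.1, q.1.2, q.2.2, rfl⟩
    linarith
  obtain ⟨⟨x, y⟩, ⟨hx, hy⟩, hxy⟩ := hpair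
  set d := (∑ k, g k * y k) - ∑ k, g k * x k with hd
  have key : ∀ α : ℝ, 0 < α → ∀ ψ ∈ O.F,
      2 * c ≤ α * ((K : ℝ) * (O.Phi ψ (A i x) + O.Phi (fun ω => -ψ ω) (A j y)) + 2 * L) + d := by
    intro α hα ψ hψ
    have h := hxy ⟨(α, α • ψ), hα, O.F.smul_mem α hψ⟩
    have e1 : (fun ω => (α • ψ) ω / α) = ψ := by
      ext ω; simp [hα.ne']
    have e2 : (fun ω => -(α • ψ) ω / α) = fun ω => -ψ ω := by
      ext ω; simp [neg_div, hα.ne']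
    simp only [f, psiPlusFun, psiMinusFun, e1, e2, ← hLdef] at h
    linarith
  refine ⟨x, hx, y, hy, ?_, fun ψ hψ => ?_⟩
  · refine le_of_forall_pos_le_add fun δ hδ => ?_
    set B := (K : ℝ) * (O.Phi (fun _ => 0) (A i x) + O.Phi (fun ω => -(fun _ => 0) ω) (A j y)) + 2 * L
    have hB : B = 2 * L := by
      simp [B, O.Phi_zero (hAi x hx), O.Phi_zero (hAj y hy)]
    have h := key (δ / (2 * L + 1)) (by positivity) (fun _ => 0) (O.F.zero_mem)
    change 2 * c ≤ _ * B + d at h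
    rw [hB] at h
    have : δ / (2 * L + 1) * (2 * L) ≤ δ := by
      rw [div_mul_eq_mul_div, div_le_iff₀ (by positivity)]
      nlinarith
    linarith
  · by_contra! hneg
    set B := (K : ℝ) * (O.Phi ψ (A i x) + O.Phi (fun ω => -ψ ω) (A j y)) + 2 * L
    have h := key ((|d - 2 * c| + 1) / (-B)) (div_pos (by positivity) (by linarith)) ψ hψ
    change 2 * c ≤ _ * B + d at h
    rw [div_neg, neg_mul, div_mul_cancel₀ _ hneg.ne] at h
    linarith [le_abs_self (d - 2 * c)]

end SaddlePoint

section LowerBound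

variable {Ω : Type} [TopologicalSpace Ω] [PolishSpace Ω] [MeasurableSpace Ω] [BorelSpace Ω]
  {m n : ℕ} {ι : Type} [Fintype ι] (O : GoodOS Ω m)

/-- The element of `F` at which the log-Hellinger affinity of `p_μ` and `p_ν` is attained. -/
noncomputable def GoodOS.halfLogRatio (μ ν : Fin m → ℝ) : Ω → ℝ :=
  fun ω => 1 / 2 * Real.log (O.p ν ω / O.p μ ω)

variable {O}

lemma GoodOS.halfLogRatio_mem {μ ν : Fin m → ℝ} (hμ : μ ∈ O.M) (hν : ν ∈ O.M) :
    O.halfLogRatio μ ν ∈ O.F :=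
  O.F.smul_mem (1 / 2) (O.F_logratio ν hν μ hμ)

lemma exp_half_log_div_mul {a b : ℝ} (ha : 0 < a) (hb : 0 < b) :
    Real.exp (1 / 2 * Real.log (b / a)) * a = √(a * b) := by
  have h : Real.exp (1 / 2 * Real.log (b / a)) = √(b / a) := by
    rw [Real.sqrt_eq_rpow, Real.rpow_def_of_pos (div_pos hb ha), mul_comm]
  rw [h, Real.sqrt_div hb.le, Real.sqrt_mul ha.le]
  have := Real.sqrt_pos.2 ha
  field_simp
  rw [Real.sq_sqrt ha.le]

lemma GoodOS.exp_halfLogRatio_mul {μ ν : Fin m → ℝ} (hμ : μ ∈ O.M) (hν : ν ∈ O.M) (ω : Ω) :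
    Real.exp (O.halfLogRatio μ ν ω) * O.p μ ω = √(O.p μ ω * O.p ν ω) :=
  exp_half_log_div_mul (O.p_pos μ hμ ω) (O.p_pos ν hν ω)

lemma GoodOS.neg_halfLogRatio {μ ν : Fin m → ℝ} :
    (fun ω => -O.halfLogRatio μ ν ω) = O.halfLogRatio ν μ := by
  ext ω
  simp only [halfLogRatio]
  rw [← inv_div (O.p ν ω) (O.p μ ω), Real.log_inv]
  ring

lemma GoodOS.Phi_halfLogRatio_comm {μ ν : Fin m → ℝ} (hμ : μ ∈ O.M) (hν : ν ∈ O.M) :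
    O.Phi (O.halfLogRatio μ ν) μ = O.Phi (O.halfLogRatio ν μ) ν := by
  simp only [GoodOS.Phi, O.exp_halfLogRatio_mul hμ hν, O.exp_halfLogRatio_mul hν hμ, mul_comm]

lemma GoodOS.measurable_p {μ : Fin m → ℝ} (hμ : μ ∈ O.M) : Measurable (O.p μ) := by
  have : Continuous fun ω => (fun q : (Fin m → ℝ) × Ω => O.p q.1 q.2) (μ, ω) :=
    O.p_cont.comp_continuous (by fun_prop) fun ω => ⟨hμ, Set.mem_univ _⟩
  exact this.measurable

lemma GoodOS.integrable_p {μ : Fin m → ℝ} (hμ : μ ∈ O.M) : Integrable (O.p μ) O.P := by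
  by_contra h
  have := O.p_prob μ hμ
  rw [integral_undef h] at this
  exact zero_ne_one this

lemma GoodOS.setIntegral_prod_le {μ : Fin m → ℝ} (hμ : μ ∈ O.M) {N : ℕ}
    {B : Set (Fin N → Ω)} (hB : MeasurableSet B) {ε : ℝ} (hε : 0 ≤ ε)
    (h : prodDensityMeasure O.P N (O.p μ) B ≤ ENNReal.ofReal ε) :
    ∫ y in B, ∏ k, O.p μ (y k) ∂(Measure.pi fun _ : Fin N => O.P) ≤ ε := by
  have := O.sigmaFinite
  rw [prodDensityMeasure, withDensity_apply _ hB, ← ofReal_integral_eq_lintegral_ofReal] at h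
  · exact (ENNReal.ofReal_le_ofReal_iff hε).1 h
  · exact (Integrable.fintype_prod fun _ => O.integrable_p hμ).integrableOn
  · exact Filter.Eventually.of_forall fun y => Finset.prod_nonneg fun k _ => (O.p_pos μ hμ _).le

/-- If `N` observations allow to distinguish `μ` from `ν` with error probabilities at most `ε`,
then the Hellinger affinity of `p_μ` and `p_ν` is small. -/
lemma GoodOS.Phi_halfLogRatio_le_of_test {μ ν : Fin m → ℝ} (hμ : μ ∈ O.M) (hν : ν ∈ O.M)
    {N : ℕ} {B : Set (Fin N → Ω)} (hB : MeasurableSet B) {ε : ℝ} (hε : 0 < ε)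
    (hε2 : ε ≤ 1 / 2) (hμB : prodDensityMeasure O.P N (O.p μ) B ≤ ENNReal.ofReal ε)
    (hνB : prodDensityMeasure O.P N (O.p ν) Bᶜ ≤ ENNReal.ofReal ε) :
    2 * ((N : ℝ) * O.Phi (O.halfLogRatio μ ν) μ) ≤ Real.log (4 * ε * (1 - ε)) := by
  have := O.sigmaFinite
  have hInt : ∀ {κ : Fin m → ℝ}, κ ∈ O.M → Integrable (fun y : Fin N → Ω => ∏ k, O.p κ (y k))
      (Measure.pi fun _ : Fin N => O.P) := fun hκ =>
    Integrable.fintype_prod fun _ => O.integrable_p hκ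
  have hone : ∀ {κ : Fin m → ℝ}, κ ∈ O.M →
      ∫ y : Fin N → Ω, ∏ k, O.p κ (y k) ∂(Measure.pi fun _ : Fin N => O.P) = 1 := fun hκ => by
    rw [integral_fintype_prod_eq_pow, O.p_prob _ hκ, one_pow]
  have haff : ∫ y : Fin N → Ω, √((∏ k, O.p μ (y k)) * ∏ k, O.p ν (y k))
      ∂(Measure.pi fun _ : Fin N => O.P) = Real.exp (N * O.Phi (O.halfLogRatio μ ν) μ) := by
    have hpt : ∀ y : Fin N → Ω, √((∏ k, O.p μ (y k)) * ∏ k, O.p ν (y k)) =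
        ∏ k, Real.exp (O.halfLogRatio μ ν (y k)) * O.p μ (y k) := fun y => by
      simp only [O.exp_halfLogRatio_mul hμ hν]
      rw [← Finset.prod_mul_distrib, Real.sqrt_prod]
      exact fun k _ => mul_nonneg (O.p_pos μ hμ _).le (O.p_pos ν hν _).le
    simp only [hpt]
    rw [integral_fintype_prod_eq_pow (ι := Fin N)
      (fun ω => Real.exp (O.halfLogRatio μ ν ω) * O.p μ ω),
      O.integral_exp_mul_eq_exp_Phi (O.halfLogRatio_mem hμ hν) hμ, Fintype.card_fin,
      ← Real.exp_nat_mul]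
  have h := sq_integral_sqrt_mul_le
    (fun y => Finset.prod_nonneg fun k _ => (O.p_pos μ hμ (y k)).le)
    (fun y => Finset.prod_nonneg fun k _ => (O.p_pos ν hν (y k)).le)
    (hInt hμ) (hInt hν) (hone hμ) (hone hν) hB hε2
    (O.setIntegral_prod_le hμ hB hε.le hμB) (O.setIntegral_prod_le hν hB.compl hε.le hνB)
    (by rw [haff]; exact Real.exp_pos _)
  rw [haff, ← Real.exp_nat_mul] at h
  have h4 : 0 < 4 * ε * (1 - ε) := by
    have : 0 < 1 - ε := by linarith
    positivity
  rw [Real.le_log_iff_exp_le h4]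
  exact_mod_cast h

/-- The log-Hellinger affinity does not drop faster than linearly along the segment leading from
a pair of coinciding parameters. -/
lemma GoodOS.mul_le_Phi_halfLogRatio {μ ν κ : Fin m → ℝ} (hμ : μ ∈ O.M) (hν : ν ∈ O.M)
    (hκ : κ ∈ O.M) {b : ℝ} (hb : ∀ ψ ∈ O.F, b ≤ O.Phi ψ μ + O.Phi (fun ω => -ψ ω) ν)
    {t : ℝ} (ht0 : 0 ≤ t) (ht1 : t ≤ 1) :
    t * b ≤ 2 * O.Phi (O.halfLogRatio (t • μ + (1 - t) • κ) (t • ν + (1 - t) • κ))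
      (t • μ + (1 - t) • κ) := by
  have hs : 0 ≤ 1 - t := by linarith
  have hμt := O.M_convex hμ hκ ht0 hs (by ring)
  have hνt := O.M_convex hν hκ ht0 hs (by ring)
  set ψ := O.halfLogRatio (t • μ + (1 - t) • κ) (t • ν + (1 - t) • κ) with hψdef
  have hψ : ψ ∈ O.F := O.halfLogRatio_mem hμt hνt
  have hcomm : O.Phi ψ (t • μ + (1 - t) • κ) =
      O.Phi (fun ω => -ψ ω) (t • ν + (1 - t) • κ) := by
    rw [hψdef, O.Phi_halfLogRatio_comm hμt hνt, GoodOS.neg_halfLogRatio]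
  have h1 : t * O.Phi ψ μ + (1 - t) * O.Phi ψ κ ≤ O.Phi ψ (t • μ + (1 - t) • κ) :=
    (O.mgf_concave ψ hψ).2 hμ hκ ht0 hs (by ring)
  have h2 : t * O.Phi (fun ω => -ψ ω) ν + (1 - t) * O.Phi (fun ω => -ψ ω) κ ≤
      O.Phi (fun ω => -ψ ω) (t • ν + (1 - t) • κ) :=
    (O.mgf_concave _ (O.neg_mem hψ)).2 hν hκ ht0 hs (by ring)
  have h3 := mul_nonneg hs (O.Phi_add_Phi_neg_nonneg hψ hκ)
  have h4 := mul_le_mul_of_nonneg_left (hb ψ hψ) ht0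
  linarith

variable {X : ι → Set (Fin n → ℝ)} {A : ι → (Fin n → ℝ) →ᵃ[ℝ] (Fin m → ℝ)} {g : Fin n → ℝ}
  {ε : ℝ} {K Kb : ℕ}

lemma mul_le_of_lt_OptIJ (hXconv : ∀ j, Convex ℝ (X j)) (hXcomp : ∀ j, IsCompact (X j))
    (hA : ∀ j, ∀ x ∈ X j, A j x ∈ O.M) {i j : ι}
    (hcommon : ∃ xbar, xbar ∈ X i ∩ X j ∧ A i xbar = A j xbar)
    (hε : 0 < ε) (hε2 : ε < 1 / 2) (hKb : 0 < Kb) (hKKb : Kb ≤ K)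
    (hL : 0 ≤ Real.log (2 * (Fintype.card ι : ℝ) / ε))
    {c : ℝ} (hc : c < OptIJ O X A g ε K i j) {t : ℝ} (ht0 : 0 ≤ t) (ht1 : t ≤ 1)
    (ht : 2 * t * Real.log (2 * (Fintype.card ι : ℝ) / ε) < Real.log (1 / (4 * ε * (1 - ε))))
    {ρ : ℝ} {ghat : (Fin Kb → Ω) → ℝ} (hghat : Measurable ghat)
    (hρ : ∀ j : ι, ∀ x ∈ X j, prodDensityMeasure O.P Kb (O.p (A j x))
        {y | ρ < |ghat y - ∑ i, g i * x i|} ≤ ENNReal.ofReal ε) :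
    t * c ≤ ρ := by
  obtain ⟨x, hx, y, hy, hgap, hψ⟩ := exists_pair_of_lt_OptIJ g ε K (hXcomp i) (hXcomp j)
    (hXconv i) (hXconv j) (hA i) (hA j) hcommon hL hc
  obtain ⟨z, ⟨hzi, hzj⟩, hz⟩ := hcommon
  set L := Real.log (2 * (Fintype.card ι : ℝ) / ε)
  by_contra! hlt
  have hs : 0 ≤ 1 - t := by linarith
  have hxt : t • x + (1 - t) • z ∈ X i := hXconv i hx hzi ht0 hs (by ring)
  have hyt : t • y + (1 - t) • z ∈ X j := hXconv j hy hzj ht0 hs (by ring)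
  set gx := ∑ k, g k * (t • x + (1 - t) • z) k with hgx
  set gy := ∑ k, g k * (t • y + (1 - t) • z) k with hgy
  have hsep : 2 * ρ < gy - gx := by
    have := mul_le_mul_of_nonneg_left hgap ht0
    rw [hgx, hgy, sum_mul_combo, sum_mul_combo]
    linarith
  have hAx : A i (t • x + (1 - t) • z) = t • A i x + (1 - t) • A i z :=
    Convex.combo_affine_apply (by ring)
  have hAy : A j (t • y + (1 - t) • z) = t • A j y + (1 - t) • A i z := by
    rw [hz]; exact Convex.combo_affine_apply (by ring)
  have htest := O.Phi_halfLogRatio_le_of_test (hA i _ hxt) (hA j _ hyt)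
    (measurableSet_lt measurable_const hghat : MeasurableSet {ξ | (gx + gy) / 2 < ghat ξ})
    hε hε2.le
    ((measure_mono fun ξ hξ => by
      have hξ' : (gx + gy) / 2 < ghat ξ := hξ
      exact lt_of_lt_of_le (by linarith) (le_abs_self (ghat ξ - gx))).trans (hρ i _ hxt))
    ((measure_mono fun ξ hξ => by
      have hξ' : ghat ξ ≤ (gx + gy) / 2 := not_lt.1 hξ
      exact lt_of_lt_of_le (by linarith) (neg_le_abs (ghat ξ - gy))).trans (hρ j _ hyt))
  have hK : (0 : ℝ) < K := by exact_mod_cast hKb.trans_le hKKb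
  have haff := O.mul_le_Phi_halfLogRatio (hA i x hx) (hA j y hy) (hA i z hzi) (b := -(2 * L) / K)
    (fun ψ hψF => by rw [div_le_iff₀ hK]; linarith [hψ ψ hψF]) ht0 ht1
  rw [← hAx, ← hAy] at haff
  set a := O.Phi (O.halfLogRatio (A i (t • x + (1 - t) • z)) (A j (t • y + (1 - t) • z)))
    (A i (t • x + (1 - t) • z))
  rw [one_div, Real.log_inv] at ht
  have hKa : -(t * L) ≤ K * a := by
    have := mul_le_mul_of_nonneg_left haff hK.le
    have e : (K : ℝ) * (t * (-(2 * L) / K)) = -(2 * (t * L)) := by field_simp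
    rw [e] at this
    linarith
  have hKba : -(t * L) ≤ Kb * a := by
    rcases le_total 0 a with ha | ha
    · have h1 := mul_nonneg ht0 hL
      have h2 := mul_nonneg (Nat.cast_nonneg (α := ℝ) Kb) ha
      linarith
    · exact hKa.trans (mul_le_mul_of_nonpos_right (by exact_mod_cast hKKb) ha)
  linarith

lemma exists_risk_bound (hXcomp : ∀ j, IsCompact (X j)) :
    ∃ ρ : ℝ, ∃ ghat : (Fin Kb → Ω) → ℝ, Measurable ghat ∧
      ∀ j : ι, ∀ x ∈ X j, prodDensityMeasure O.P Kb (O.p (A j x))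
        {y | ρ < |ghat y - ∑ i, g i * x i|} ≤ ENNReal.ofReal ε := by
  obtain ⟨ρ, hρ⟩ := (isCompact_iUnion hXcomp).bddAbove_image
    (f := fun x => |∑ i, g i * x i|) (by fun_prop)
  refine ⟨ρ, fun _ => 0, measurable_const, fun j x hx => ?_⟩
  have hx' : |∑ i, g i * x i| ≤ ρ := hρ ⟨x, Set.mem_iUnion.2 ⟨j, hx⟩, rfl⟩
  simp [hx'.not_gt]

end LowerBound

/-- **Proposition 2, part (ii).** In a good observation scheme, for the
linear-form recovery problem, if for every pair `i,j` there is `x̄ ∈ X_i ∩ X_j` with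
`A_i(x̄) = A_j(x̄)`, then for every `ε ∈ (0,1/2)` and all positive integers `K ≥ K̄`,
`Opt(K) ≤ [2 ln(2I/ε) / ln(1/(4ε(1−ε)))] · Risk*_ε(K̄)`. -/
theorem opt_le_factor_mul_minimax_risk {Ω : Type} [TopologicalSpace Ω] [PolishSpace Ω]
    [MeasurableSpace Ω] [BorelSpace Ω] {m n : ℕ} {ι : Type} [Fintype ι] [Nonempty ι]
    (O : GoodOS Ω m)
    (X : ι → Set (Fin n → ℝ))
    (hXne : ∀ j, (X j).Nonempty) (hXconv : ∀ j, Convex ℝ (X j))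
    (hXcomp : ∀ j, IsCompact (X j))
    (A : ι → (Fin n → ℝ) →ᵃ[ℝ] (Fin m → ℝ)) (hA : ∀ j, ∀ x ∈ X j, A j x ∈ O.M)
    (hcommon : ∀ i j : ι, ∃ xbar, xbar ∈ X i ∩ X j ∧ A i xbar = A j xbar)
    (g : Fin n → ℝ)
    (ε : ℝ) (hε : 0 < ε) (hε2 : ε < 1 / 2)
    (Kb : ℕ) (hKb : 0 < Kb) (K : ℕ) (hKKb : Kb ≤ K) :
    OptTotal O X A g ε K ≤
      2 * Real.log (2 * (Fintype.card ι : ℝ) / ε) /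
        Real.log (1 / (4 * ε * (1 - ε))) * RiskStar O X A g ε Kb := by
  have hI : (1 : ℝ) ≤ Fintype.card ι := by exact_mod_cast Fintype.card_pos (α := ι)
  set L := Real.log (2 * (Fintype.card ι : ℝ) / ε) with hLdef
  set D := Real.log (1 / (4 * ε * (1 - ε))) with hDdef
  have h4 : 0 < 4 * ε * (1 - ε) := by
    have : 0 < 1 - ε := by linarith
    positivity
  have hD : 0 < D := by
    refine Real.log_pos ?_
    rw [lt_div_iff₀ h4]
    nlinarith [mul_pos (sub_pos.2 hε2) (sub_pos.2 hε2)]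
  have hDL : D ≤ L := by
    refine Real.log_le_log (by positivity) ?_
    rw [div_le_div_iff₀ h4 hε]
    nlinarith [mul_pos hε (sub_pos.2 hε2), mul_nonneg (sub_nonneg.2 hI) h4.le]
  have hL : 0 < L := hD.trans_le hDL
  refine Finset.sup'_le _ _ fun q _ => le_of_forall_lt_imp_le_of_dense fun c hc => ?_
  set τ := D / (2 * L) with hτdef
  have hτ : 0 < τ := by positivity
  have hτ1 : τ ≤ 1 := by
    rw [div_le_one (by positivity)]
    linarith
  have hrisk : τ * c ≤ RiskStar O X A g ε Kb := by
    refine le_csInf (exists_risk_bound hXcomp) ?_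
    rintro ρ ⟨ghat, hghat, hρ⟩
    refine le_of_tendsto (f := fun t => t * c) (x := nhdsWithin τ (Set.Iio τ))
      ((continuous_id.mul continuous_const).continuousWithinAt.tendsto) ?_
    filter_upwards [Ioo_mem_nhdsLT hτ] with t ht
    refine mul_le_of_lt_OptIJ hXconv hXcomp hA (hcommon q.1 q.2) hε hε2 hKb hKKb hL.le hc
      ht.1.le (ht.2.le.trans hτ1) ?_ hghat hρ
    have := (lt_div_iff₀ (by positivity)).1 ht.2
    linarith
  calc c = 2 * L / D * (τ * c) := by rw [hτdef]; field_simp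
    _ ≤ _ := mul_le_mul_of_nonneg_left hrisk (by positivity)
end

section
/- Let O = ((Ω,P), {p_μ : μ∈M}, F) be a good observation scheme, let M_1, M_2 be nonempty convex compact subsets of M, let ε ∈ (0,1/2) and let K̄ be a positive integer. Suppose there exists a test deciding on H_1 : μ ∈ M_1 versus H_2 : μ ∈ M_2 from K̄ i.i.d. observations with risk at most ε, i.e., a Borel set B ⊆ Ω^{K̄} such that for all μ ∈ M_1 the p_μ^{K̄}-probability of Ω^{K̄}∖B is at most ε and for all ν ∈ M_2 the p_ν^{K̄}-probability of B is at most ε. Then ε_* := exp( max_{μ∈M_1, ν∈M_2} ln(∫_Ω √(p_μ p_ν) dP) ) satisfies ε_* ≤ [2√(ε(1−ε))]^{1/K̄}. -/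
open MeasureTheory

/-- If a test separates two probability densities `F` and `G` with both error probabilities at
most `ε < 1/2`, then their Hellinger affinity is at most `2√(ε(1-ε))`. -/
theorem integral_sqrt_mul_le_of_test {X : Type*} [MeasurableSpace X] {π : Measure X}
    {F G : X → ℝ} (hF : Integrable F π) (hG : Integrable G π) (hF0 : 0 ≤ F) (hG0 : 0 ≤ G)
    (hF1 : ∫ x, F x ∂π = 1) (hG1 : ∫ x, G x ∂π = 1)
    (hFG : Integrable (fun x => √(F x * G x)) π)
    {ε : ℝ} (hε : 0 < ε) (hε2 : ε < 1 / 2) {B : Set X} (hB : MeasurableSet B)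
    (hBF : ∫ x in Bᶜ, F x ∂π ≤ ε) (hBG : ∫ x in B, G x ∂π ≤ ε) :
    ∫ x, √(F x * G x) ∂π ≤ 2 * √(ε * (1 - ε)) := by
  set e := √ε with he
  set f := √(1 - ε) with hf
  have he0 : 0 < e := Real.sqrt_pos.2 hε
  have hf0 : 0 < f := Real.sqrt_pos.2 (by linarith)
  have he2 : e ^ 2 = ε := Real.sq_sqrt hε.le
  have hf2 : f ^ 2 = 1 - ε := Real.sq_sqrt (by linarith)
  -- Weighted AM-GM, with weights chosen separately on the two sides of the test.
  have amgm : ∀ {a b s t : ℝ}, 0 ≤ a → 0 ≤ b → 0 < s → 0 < t →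
      √(a * b) ≤ (s / t * a + t / s * b) / 2 := by
    intro a b s t ha hb hs ht
    apply Real.sqrt_le_iff.2
    refine ⟨by positivity, ?_⟩
    have h : s / t * (t / s) = 1 := by field_simp
    have h' : a * b = (s / t * a) * (t / s * b) := by linear_combination (-a * b) * h
    rw [h']
    nlinarith [sq_nonneg (s / t * a - t / s * b)]
  have hsum : ∫ x, √(F x * G x) ∂π ≤
      (e / f * (∫ x in B, F x ∂π) + f / e * (∫ x in B, G x ∂π)) / 2 +
      (f / e * (∫ x in Bᶜ, F x ∂π) + e / f * (∫ x in Bᶜ, G x ∂π)) / 2 := by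
    rw [← integral_add_compl hB hFG]
    have key : ∀ (S : Set X) {s t : ℝ}, 0 < s → 0 < t → ∫ x in S, √(F x * G x) ∂π ≤
        (s / t * (∫ x in S, F x ∂π) + t / s * (∫ x in S, G x ∂π)) / 2 := by
      intro S s t hs ht
      have h1 : Integrable (fun x => s / t * F x) (π.restrict S) :=
        hF.integrableOn.const_mul _
      have h2 : Integrable (fun x => t / s * G x) (π.restrict S) :=
        hG.integrableOn.const_mul _
      rw [← integral_const_mul, ← integral_const_mul, ← integral_add h1 h2,
        ← integral_div]
      exact integral_mono hFG.integrableOn ((h1.add h2).div_const 2)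
        fun x => amgm (hF0 x) (hG0 x) hs ht
    exact add_le_add (key B he0 hf0) (key Bᶜ hf0 he0)
  have hFs := integral_add_compl hB hF
  have hGs := integral_add_compl hB hG
  rw [hF1] at hFs
  rw [hG1] at hGs
  rw [Real.sqrt_mul hε.le, ← he, ← hf]
  have hef : e / f ≤ f / e := by
    rw [div_le_div_iff₀ hf0 he0]
    nlinarith
  have h1 : e / f * (1 - ε) = e * f := by rw [← hf2]; field_simp
  have h2 : f / e * ε = e * f := by rw [← he2]; field_simp
  rw [show ∫ x in B, F x ∂π = 1 - ∫ x in Bᶜ, F x ∂π by linarith,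
    show ∫ x in Bᶜ, G x ∂π = 1 - ∫ x in B, G x ∂π by linarith] at hsum
  nlinarith [mul_le_mul_of_nonneg_left hBF (sub_nonneg.2 hef),
    mul_le_mul_of_nonneg_left hBG (sub_nonneg.2 hef)]

/-- The geometric mean of two nonnegative integrable functions is integrable. -/
theorem integrable_sqrt_mul {X : Type*} [MeasurableSpace X] {P : Measure X} {f g : X → ℝ}
    (hf : Integrable f P) (hg : Integrable g P) (hf0 : 0 ≤ f) (hg0 : 0 ≤ g) :
    Integrable (fun x => √(f x * g x)) P := by
  refine (hf.add hg).mono'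
    (Real.continuous_sqrt.comp_aestronglyMeasurable (hf.1.mul hg.1)) (ae_of_all _ fun x => ?_)
  have hx := hf0 x
  have hy := hg0 x
  simp only [Pi.zero_apply] at hx hy
  rw [Real.norm_of_nonneg (Real.sqrt_nonneg _), Pi.add_apply]
  exact Real.sqrt_le_iff.2 ⟨by positivity,
    by nlinarith [mul_nonneg hx hy, sq_nonneg (f x), sq_nonneg (g x)]⟩

/-- An upper bound on the `K`-fold product measure of a set bounds the integral of the product
density over it. -/
theorem setIntegral_prod_le_of_prodDensityMeasure_le {Ω : Type*} [MeasurableSpace Ω]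
    {P : Measure Ω} [SigmaFinite P] {K : ℕ} {f : Ω → ℝ} (hf : Integrable f P) (hf0 : 0 ≤ f)
    {B : Set (Fin K → Ω)} (hB : MeasurableSet B) {ε : ℝ} (hε : 0 ≤ ε)
    (h : prodDensityMeasure P K f B ≤ ENNReal.ofReal ε) :
    ∫ y in B, ∏ k, f (y k) ∂(Measure.pi fun _ => P) ≤ ε := by
  rw [prodDensityMeasure, withDensity_apply _ hB, ← ofReal_integral_eq_lintegral_ofReal
    (Integrable.fintype_prod fun _ => hf).integrableOn
    (ae_of_all _ fun y => Finset.prod_nonneg fun k _ => hf0 (y k))] at h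
  exact (ENNReal.ofReal_le_ofReal_iff hε).1 h

/-- In a good observation scheme, if some test (acceptance region `B`)
decides between `H₁ : μ ∈ M₁` and `H₂ : μ ∈ M₂` from `K̄` i.i.d. observations with risk
at most `ε < 1/2`, then `ε_* = exp(max_{μ∈M₁,ν∈M₂} ln ∫ √(p_μ p_ν) dP)` satisfies
`ε_* ≤ (2√(ε(1-ε)))^{1/K̄}`. -/
theorem hellinger_sup_bound_of_test {Ω : Type} [TopologicalSpace Ω] [PolishSpace Ω]
    [MeasurableSpace Ω] [BorelSpace Ω] {m : ℕ} (O : GoodOS Ω m)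
    (M₁ M₂ : Set (Fin m → ℝ)) (h₁ne : M₁.Nonempty) (h₂ne : M₂.Nonempty)
    (h₁M : M₁ ⊆ O.M) (h₂M : M₂ ⊆ O.M)
    (h₁c : Convex ℝ M₁) (h₁k : IsCompact M₁)
    (h₂c : Convex ℝ M₂) (h₂k : IsCompact M₂)
    (ε : ℝ) (hε : 0 < ε) (hε2 : ε < 1 / 2)
    (Kb : ℕ) (hKb : 0 < Kb)
    (B : Set (Fin Kb → Ω)) (hB : MeasurableSet B)
    (hrisk1 : ∀ μ ∈ M₁, prodDensityMeasure O.P Kb (O.p μ) Bᶜ ≤ ENNReal.ofReal ε)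
    (hrisk2 : ∀ ν ∈ M₂, prodDensityMeasure O.P Kb (O.p ν) B ≤ ENNReal.ofReal ε) :
    Real.exp (sSup {v | ∃ μ ∈ M₁, ∃ ν ∈ M₂,
        v = Real.log (∫ ω, Real.sqrt (O.p μ ω * O.p ν ω) ∂O.P)}) ≤
      (2 * Real.sqrt (ε * (1 - ε))) ^ ((Kb : ℝ)⁻¹) := by
  have := O.sigmaFinite
  have hint : ∀ μ ∈ O.M, Integrable (O.p μ) O.P := fun μ hμ => by
    by_contra h
    simpa [integral_undef h] using O.p_prob μ hμ
  have hnn : ∀ μ ∈ O.M, 0 ≤ O.p μ := fun μ hμ ω => (O.p_pos μ hμ ω).le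
  have hc : 0 < 2 * √(ε * (1 - ε)) := by
    have : 0 < ε * (1 - ε) := mul_pos hε (by linarith)
    positivity
  have hr : 0 < (2 * √(ε * (1 - ε))) ^ ((Kb : ℝ)⁻¹) := Real.rpow_pos_of_pos hc _
  rw [← Real.le_log_iff_exp_le hr]
  obtain ⟨μ₀, hμ₀⟩ := h₁ne
  obtain ⟨ν₀, hν₀⟩ := h₂ne
  refine csSup_le ⟨_, μ₀, hμ₀, ν₀, hν₀, rfl⟩ ?_
  rintro _ ⟨μ, hμ, ν, hν, rfl⟩
  have hμM := h₁M hμ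
  have hνM := h₂M hν
  have hs := integrable_sqrt_mul (hint μ hμM) (hint ν hνM) (hnn μ hμM) (hnn ν hνM)
  have hP : O.P ≠ 0 := fun h => by simpa [h] using O.p_prob μ hμM
  have hpos : 0 < ∫ ω, √(O.p μ ω * O.p ν ω) ∂O.P := by
    rw [integral_pos_iff_support_of_nonneg (fun _ => Real.sqrt_nonneg _) hs]
    have : Function.support (fun ω => √(O.p μ ω * O.p ν ω)) = Set.univ :=
      Set.eq_univ_of_forall fun ω =>
        (Real.sqrt_pos.2 (mul_pos (O.p_pos μ hμM ω) (O.p_pos ν hνM ω))).ne'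
    rw [this]
    exact Measure.measure_univ_pos.2 hP
  refine Real.log_le_log hpos ((Real.le_rpow_inv_iff_of_pos hpos.le hc.le
    (Nat.cast_pos.2 hKb)).2 ?_)
  have hprod : ∀ y : Fin Kb → Ω, √((∏ k, O.p μ (y k)) * ∏ k, O.p ν (y k)) =
      ∏ k, √(O.p μ (y k) * O.p ν (y k)) := fun y => by
    rw [← Finset.prod_mul_distrib, Real.sqrt_prod _ fun k _ =>
      mul_nonneg (hnn μ hμM (y k)) (hnn ν hνM (y k))]
  have hprob : ∀ μ ∈ O.M, ∫ y : Fin Kb → Ω, ∏ k, O.p μ (y k) ∂(Measure.pi fun _ => O.P) = 1 :=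
    fun μ hμ => by
      rw [integral_fintype_prod_eq_pow, O.p_prob μ hμ, one_pow]
  have hprodint : ∀ μ ∈ O.M, Integrable (fun y : Fin Kb → Ω => ∏ k, O.p μ (y k))
      (Measure.pi fun _ => O.P) := fun μ hμ => Integrable.fintype_prod fun _ => hint μ hμ
  have hprodnn : ∀ μ ∈ O.M, 0 ≤ fun y : Fin Kb → Ω => ∏ k, O.p μ (y k) :=
    fun μ hμ y => Finset.prod_nonneg fun k _ => hnn μ hμ (y k)
  have key := integral_sqrt_mul_le_of_test (hprodint μ hμM) (hprodint ν hνM) (hprodnn μ hμM)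
    (hprodnn ν hνM) (hprob μ hμM) (hprob ν hνM)
    (integrable_sqrt_mul (hprodint μ hμM) (hprodint ν hνM) (hprodnn μ hμM) (hprodnn ν hνM))
    hε hε2 hB
    (setIntegral_prod_le_of_prodDensityMeasure_le (hint μ hμM) (hnn μ hμM) hB.compl hε.le
      (hrisk1 μ hμ))
    (setIntegral_prod_le_of_prodDensityMeasure_le (hint ν hνM) (hnn ν hνM) hB hε.le
      (hrisk2 ν hν))
  simp_rw [hprod] at key
  rw [integral_fintype_prod_eq_pow (fun ω => √(O.p μ ω * O.p ν ω)), Fintype.card_fin] at key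
  rwa [Real.rpow_natCast]
end
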